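/- Let L be the language with unary predicates Q, R and a ternary relation E, and let M be the L-structure with universe (ℕ × ℕ) ⊔ {0,1}, where Q is interpreted as ℕ × ℕ, R as {0,1}, and E(x,y,r) holds iff x,y ∈ Q, r ∈ R, and x and y have the same r-th coordinate. Let A = {(n, n+1) : n ∈ ℕ} ⊆ Q, and let L* = L ∪ {P} with P a unary predicate interpreted as A. Then the L*-formula φ(v) := ∀x (Q(x) → ∃y (P(y) ∧ E(x,y,v))) is satisfied in (M,A) by 0 but not by 1; consequently A is not benign in M. -/

import Mathlib

open FirstOrder Language Cardinal

universe u

namespace Benign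

variable {L : FirstOrder.Language.{u, u}} {M : Type u} [L.Structure M]

/-- Two tuples (indexed by a type `α`) realize the same complete `L`-type over the
parameter set `A`. -/
def SameTypeOver (A : Set M) {α : Type} (x y : α → M) : Prop :=
  ∀ φ : L.Formula (α ⊕ ↥A),
    φ.Realize (Sum.elim x Subtype.val) ↔ φ.Realize (Sum.elim y Subtype.val)

/-- Two tuples realize the same strong type over `A`: they realize the same type over `A`,
and they are equivalent under every `A`-definable equivalence relation with finitely many
classes. -/
def SameStrongTypeOver (A : Set M) {α : Type} (x y : α → M) : Prop :=
  SameTypeOver (L := L) A x y ∧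
    ∀ φ : L.Formula ((α ⊕ α) ⊕ ↥A),
      (Equivalence fun u v : α → M => φ.Realize (Sum.elim (Sum.elim u v) Subtype.val)) →
      (∃ k : ℕ, ∀ g : Fin (k + 1) → α → M, ∃ i j, i ≠ j ∧
          φ.Realize (Sum.elim (Sum.elim (g i) (g j)) Subtype.val)) →
      φ.Realize (Sum.elim (Sum.elim x y) Subtype.val)

/-- The language consisting of a single unary predicate symbol `P`. -/
def unaryLang : FirstOrder.Language.{0, 0} := ⟨fun _ => Empty, fun n => PLift (n = 1)⟩

/-- The interpretation of the unary predicate `P` as membership in `A`. -/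
def unaryStructure (A : Set M) : unaryLang.Structure M where
  funMap := fun f _ => f.elim
  RelMap := fun {n} r v => v (Fin.cast r.down.symm 0) ∈ A

/-- Two tuples realize the same type over `A` in the expanded language
`L* = L ∪ {P}` where the new unary predicate `P` is interpreted as `A`. -/
def SameLstarTypeOver (A : Set M) {α : Type} (x y : α → M) : Prop :=
  letI : unaryLang.Structure M := unaryStructure A
  SameTypeOver (L := L.sum unaryLang) A x y

/-- `A` is benign in `M`: tuples with the same `L`-type over `A` have the same `L*`-type
over `A`. -/
def IsBenign (A : Set M) : Prop :=
  ∀ (n : ℕ) (x y : Fin n → M),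
    SameTypeOver (L := L) A x y → SameLstarTypeOver (L := L) A x y

/-- `A` is weakly benign in `M`: tuples with the same strong type over `A` have the same
`L*`-type over `A`. -/
def IsWeaklyBenign (A : Set M) : Prop :=
  ∀ (n : ℕ) (x y : Fin n → M),
    SameStrongTypeOver (L := L) A x y → SameLstarTypeOver (L := L) A x y

/-! ### The concrete example: `Q = ℕ × ℕ`, `R = {0, 1}`,
`E(x, y, r)` iff `x, y ∈ Q`, `r ∈ R` and `x, y` have the same `r`-th coordinate. -/

/-- The relation symbols: at arity 1 the two predicates `Q` (`true`) and `R` (`false`),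
at arity 3 the single relation `E`. -/
def QRERels : ℕ → Type
  | 1 => Bool
  | 3 => Unit
  | _ => Empty

/-- The language with unary predicates `Q`, `R` and a ternary relation `E`. -/
def LQRE : FirstOrder.Language.{0, 0} := ⟨fun _ => Empty, QRERels⟩

/-- The universe `(ℕ × ℕ) ⊔ {0, 1}`. -/
abbrev MQRE : Type := (ℕ × ℕ) ⊕ Fin 2

/-- The interpretation of the relation symbols: `Q` is `ℕ × ℕ`, `R` is `{0, 1}`, and
`E(x, y, r)` holds iff `x, y ∈ Q`, `r ∈ R`, and the first coordinates of `x` and `y`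
agree when `r = 0`, the second coordinates agree when `r = 1`. -/
def QRERelInterp : ∀ n, QRERels n → (Fin n → MQRE) → Prop
  | 1, true, v => ∃ p : ℕ × ℕ, v 0 = Sum.inl p
  | 1, false, v => ∃ r : Fin 2, v 0 = Sum.inr r
  | 3, _, v => ∃ (p q : ℕ × ℕ) (r : Fin 2), v 0 = Sum.inl p ∧ v 1 = Sum.inl q ∧
      v 2 = Sum.inr r ∧ (if r = 0 then p.1 = q.1 else p.2 = q.2)

instance : LQRE.Structure MQRE where
  funMap := fun f _ => f.elim
  RelMap := fun {n} r v => QRERelInterp n r v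

/-- The set `A = {(n, n + 1) : n ∈ ℕ} ⊆ Q`: it meets every `E(·,·,0)`-class exactly once,
every `E(·,·,1)`-class except the one with second coordinate `0` exactly once, and no two
of its members are equivalent under either equivalence relation. -/
def AQRE : Set MQRE := Set.range fun n : ℕ => (Sum.inl (n, n + 1) : MQRE)


/-- The `L*`-structure on `MQRE` in which the new unary predicate `P` names `AQRE`. -/
noncomputable def MQREstar : (LQRE.sum unaryLang).Structure MQRE :=
  letI : unaryLang.Structure MQRE := unaryStructure AQRE
  inferInstance

/-- The symbol `Q`. -/
def Qsym : (LQRE.sum unaryLang).Relations 1 := Sum.inl true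

/-- The symbol `P`. -/
def Psym : (LQRE.sum unaryLang).Relations 1 := Sum.inr (PLift.up rfl)

/-- The symbol `E`. -/
def Esym : (LQRE.sum unaryLang).Relations 3 := Sum.inl ()

/-- The `L*`-formula `φ(v) := ∀x (Q(x) → ∃y (P(y) ∧ E(x, y, v)))`. -/
def phiQRE : (LQRE.sum unaryLang).Formula (Fin 1) :=
  ((Relations.boundedFormula Qsym ![Term.var (Sum.inr 0)]) ⟹
    ((Relations.boundedFormula Psym ![Term.var (Sum.inr 1)]) ⊓
      (Relations.boundedFormula Esym
        ![Term.var (Sum.inr 0), Term.var (Sum.inr 1), Term.var (Sum.inl 0)])).ex).all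

/-- `φ` holds of `x` in the `L*`-structure `(M, A)`. -/
def phiHolds (x : MQRE) : Prop :=
  letI : (LQRE.sum unaryLang).Structure MQRE := MQREstar
  phiQRE.Realize ![x]

/-- The realization of a formula only depends on the values of its free variables. -/
theorem realize_congr_of_eqOn_freeVarFinset {L : FirstOrder.Language} {M α : Type*}
    [L.Structure M] [DecidableEq α] (φ : L.Formula α) {v w : α → M}
    (h : ∀ a ∈ φ.freeVarFinset, v a = w a) : φ.Realize v ↔ φ.Realize w := by
  have hv := BoundedFormula.realize_restrictFreeVar (φ := φ) (f := id)
    (v := fun a => v a) (xs := (default : Fin 0 → M)) v (fun _ => rfl)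
  have hw := BoundedFormula.realize_restrictFreeVar (φ := φ) (f := id)
    (v := fun a => v a) (xs := (default : Fin 0 → M)) w (fun a => h a a.2)
  exact hv.symm.trans hw

/-- Tuples over `A` have the same type as soon as, for each finite set of parameters in `A`,
some automorphism fixing these parameters maps one tuple to the other. -/
theorem sameTypeOver_of_forall_finset {L : FirstOrder.Language.{u, u}} {M : Type u}
    [L.Structure M] {A : Set M} {α : Type} {x y : α → M}
    (h : ∀ s : Finset A, ∃ g : M ≃[L] M, g ∘ x = y ∧ ∀ a ∈ s, g a = a) :
    SameTypeOver (L := L) A x y := by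
  classical
  intro φ
  obtain ⟨g, hg, hs⟩ := h (φ.freeVarFinset.preimage Sum.inr Sum.inr_injective.injOn)
  rw [← StrongHomClass.realize_formula g φ]
  refine realize_congr_of_eqOn_freeVarFinset φ ?_
  rintro (i | a) ha
  · exact congrFun hg i
  · exact hs a (Finset.mem_preimage.2 ha)

/-- The cyclic permutation `0 ↦ 1 ↦ ⋯ ↦ N ↦ 0` of `ℕ`, fixing every number above `N`. -/
def initialCycle (N : ℕ) : Equiv.Perm ℕ where
  toFun n := if n < N then n + 1 else if n = N then 0 else n
  invFun m := if m = 0 then N else if m ≤ N then m - 1 else m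
  left_inv n := by grind
  right_inv m := by grind

theorem initialCycle_of_lt {N n : ℕ} (h : n < N) : initialCycle N n = n + 1 :=
  if_pos h

/-- The automorphism of `MQRE` which exchanges the two elements of `R` and maps `(a, b)` to
`(σ⁻¹ b, σ a)`. -/
def swapAut (σ : Equiv.Perm ℕ) : MQRE ≃[LQRE] MQRE where
  toEquiv := Equiv.sumCongr ((Equiv.prodComm ℕ ℕ).trans (σ.symm.prodCongr σ)) (Equiv.swap 0 1)
  map_fun' f _ := f.elim
  map_rel' := by
    intro n r v
    match n, r with
    | 1, true =>
      change (∃ p, Equiv.sumCongr _ _ (v 0) = Sum.inl p) ↔ ∃ p, v 0 = Sum.inl p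
      cases v 0 <;> simp
    | 1, false =>
      change (∃ p, Equiv.sumCongr _ _ (v 0) = Sum.inr p) ↔ ∃ p, v 0 = Sum.inr p
      cases v 0 <;> simp
    | 3, _ =>
      change (∃ (p q : ℕ × ℕ) (r : Fin 2), Equiv.sumCongr _ _ (v 0) = Sum.inl p ∧
        Equiv.sumCongr _ _ (v 1) = Sum.inl q ∧ Equiv.sumCongr _ _ (v 2) = Sum.inr r ∧
          (if r = 0 then p.1 = q.1 else p.2 = q.2)) ↔
        ∃ (p q : ℕ × ℕ) (r : Fin 2), v 0 = Sum.inl p ∧ v 1 = Sum.inl q ∧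
          v 2 = Sum.inr r ∧ (if r = 0 then p.1 = q.1 else p.2 = q.2)
      rcases v 0 with ⟨a, b⟩ | r₀ <;> rcases v 1 with ⟨c, d⟩ | r₁ <;> rcases v 2 with p | r <;>
        simp
      fin_cases r <;> simp

theorem sameTypeOver_zero_one :
    SameTypeOver (L := LQRE) AQRE ![(Sum.inr 0 : MQRE)] ![Sum.inr 1] := by
  refine sameTypeOver_of_forall_finset fun s => ?_
  choose k hk using fun a : AQRE => a.2
  refine ⟨swapAut (initialCycle (s.sup k + 1)), ?_, fun a ha => ?_⟩
  · funext i
    fin_cases i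
    rfl
  · have hσ : initialCycle (s.sup k + 1) (k a) = k a + 1 :=
      initialCycle_of_lt (Nat.lt_succ_of_le (Finset.le_sup ha))
    rw [← hk a]
    exact congrArg Sum.inl (Prod.ext ((Equiv.symm_apply_eq _).2 hσ.symm) hσ)

theorem phiHolds_inr_iff (r : Fin 2) :
    phiHolds (Sum.inr r) ↔
      ∀ p : ℕ × ℕ, ∃ n : ℕ, if r = 0 then p.1 = n else p.2 = n + 1 := by
  have h : phiHolds (Sum.inr r) ↔ ∀ x : MQRE, (∃ p : ℕ × ℕ, x = Sum.inl p) →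
      ∃ y : MQRE, y ∈ AQRE ∧ ∃ (p q : ℕ × ℕ) (t : Fin 2), x = Sum.inl p ∧ y = Sum.inl q ∧
        (Sum.inr r : MQRE) = Sum.inr t ∧ (if t = 0 then p.1 = q.1 else p.2 = q.2) := by
    let _ : (LQRE.sum unaryLang).Structure MQRE := MQREstar
    simp only [phiHolds, phiQRE, Formula.Realize, BoundedFormula.realize_all,
      BoundedFormula.realize_imp, BoundedFormula.realize_ex, BoundedFormula.realize_inf]
    rfl
  rw [h]
  simp [AQRE]

theorem not_isBenign_AQRE (h₀ : phiHolds (Sum.inr 0)) (h₁ : ¬ phiHolds (Sum.inr 1)) :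
    ¬ IsBenign (L := LQRE) AQRE := by
  intro h
  let _ : unaryLang.Structure MQRE := unaryStructure AQRE
  have hφ := h 1 _ _ sameTypeOver_zero_one (phiQRE.relabel Sum.inl)
  rw [Formula.realize_relabel, Formula.realize_relabel, Sum.elim_comp_inl,
    Sum.elim_comp_inl] at hφ
  exact h₁ (hφ.1 h₀)

/-- The `L*`-formula `φ(v) = ∀x (Q(x) → ∃y (P(y) ∧ E(x, y, v)))` is
satisfied in `(M, A)` by `0` but not by `1`; consequently `A` is not benign in `M`. -/
theorem phiQRE_separates_and_not_benign :
    phiHolds (Sum.inr 0) ∧ ¬ phiHolds (Sum.inr 1) ∧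
      ¬ IsBenign (L := LQRE) AQRE := by
  have h₀ : phiHolds (Sum.inr 0) := (phiHolds_inr_iff 0).2 fun p => ⟨p.1, rfl⟩
  have h₁ : ¬ phiHolds (Sum.inr 1) := fun h => by
    obtain ⟨n, hn⟩ := (phiHolds_inr_iff 1).1 h (0, 0)
    simp at hn
  exact ⟨h₀, h₁, not_isBenign_AQRE h₀ h₁⟩

end Benign
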